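/- Let V be a finite set of time-point variables and let C be a finite set of constraints, each of the form x < y or x = y for x, y ∈ V. Let the compound points be the equivalence classes of the equivalence relation on V generated by the equality constraints. Then there exists an assignment f : V → ℝ satisfying all constraints in C if and only if (a) no constraint x < y in C has x and y in the same compound point, and (b) the directed graph on compound points, with an edge from class [x] to class [y] whenever some constraint x < y is in C, contains no directed cycle. -/

import Mathlib

/-- The setoid on time-points whose equivalence classes are the "compound
points": the equivalence relation generated by the equality constraints. -/
def compoundSetoid {V : Type*} (eqc : V → V → Prop) : Setoid V :=
  ⟨Relation.EqvGen eqc, Relation.EqvGen.is_equivalence eqc⟩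

/-- A relation on a finite type without directed cycles admits a strictly monotone real potential. -/
theorem exists_real_potential_of_acyclic {α : Type*} [Finite α] (r : α → α → Prop)
    (h : ∀ a, ¬ Relation.TransGen r a a) : ∃ g : α → ℝ, ∀ a b, r a b → g a < g b := by
  refine ⟨fun a => ({c | Relation.TransGen r c a}.ncard : ℝ), fun a b hab => ?_⟩
  refine Nat.cast_lt.mpr (Set.ncard_lt_ncard ?_ (Set.toFinite _))
  exact (Set.ssubset_iff_of_subset fun c hc => Relation.TransGen.tail hc hab).mpr
    ⟨a, Relation.TransGen.single hab, h a⟩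

/-- A finite system of constraints `x < y` (relation `lt`) and `x = y`
(relation `eqc`) is satisfiable by a real-valued assignment iff (a) no strict
constraint relates two points of the same compound point, and (b) the directed
graph on compound points induced by the strict constraints has no directed
cycle. -/
theorem pa_satisfiable_iff_compound_acyclic {V : Type*} [Fintype V]
    (lt eqc : V → V → Prop) :
    (∃ f : V → ℝ, (∀ x y, lt x y → f x < f y) ∧ (∀ x y, eqc x y → f x = f y)) ↔
      ((∀ x y, lt x y → ¬ Relation.EqvGen eqc x y) ∧
        ∀ c : Quotient (compoundSetoid eqc),
          ¬ Relation.TransGen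
            (fun c d : Quotient (compoundSetoid eqc) =>
              ∃ x y, lt x y ∧ Quotient.mk (compoundSetoid eqc) x = c ∧
                Quotient.mk (compoundSetoid eqc) y = d) c c) := by
  constructor
  · rintro ⟨f, hlt, heq⟩
    have hgen : ∀ x y, Relation.EqvGen eqc x y → f x = f y := fun x y h => by
      induction h with
      | rel x y h => exact heq x y h
      | refl x => rfl
      | symm x y _ ih => exact ih.symm
      | trans x y z _ _ ih₁ ih₂ => exact ih₁.trans ih₂
    refine ⟨fun x y h he => (hlt x y h).ne (hgen x y he), fun c hc => ?_⟩
    let g : Quotient (compoundSetoid eqc) → ℝ := Quotient.lift f hgen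
    have hg : ∀ {c d}, Relation.TransGen
        (fun c d : Quotient (compoundSetoid eqc) =>
          ∃ x y, lt x y ∧ Quotient.mk (compoundSetoid eqc) x = c ∧
            Quotient.mk (compoundSetoid eqc) y = d) c d → g c < g d := fun h => by
      induction h with
      | single h =>
        obtain ⟨x, y, hxy, rfl, rfl⟩ := h
        exact hlt x y hxy
      | tail _ h ih =>
        obtain ⟨x, y, hxy, rfl, rfl⟩ := h
        exact ih.trans (hlt x y hxy)
    exact (hg hc).false
  · rintro ⟨-, hacyc⟩
    obtain ⟨g, hg⟩ := exists_real_potential_of_acyclic _ hacyc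
    exact ⟨fun x => g (Quotient.mk _ x), fun x y h => hg _ _ ⟨x, y, h, rfl, rfl⟩,
      fun x y h => congrArg g (Quotient.sound (Relation.EqvGen.rel x y h))⟩
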